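/- Let n ≥ 3 be a natural number and let d ≥ 4 be a real number. Then every TSP tour of the instance G(n,d) has length at least 4n + 2d − 2 − 2n/(d+1). -/

import Mathlib

open Real Filter Finset

noncomputable section

/-- Euclidean distance between two points of the plane. -/
def eucl (p q : ℝ × ℝ) : ℝ := Real.sqrt ((p.1 - q.1) ^ 2 + (p.2 - q.2) ^ 2)

/-- The points of the Euclidean TSP instance `G(n,d)`: the `3n` points
`(i, j·d)` for `i = 1,…,n` and `j = 1,2,3`, indexed by `Fin n × Fin 3`. -/
def pt (n : ℕ) (d : ℝ) (p : Fin n × Fin 3) : ℝ × ℝ :=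
  ((p.1.val : ℝ) + 1, ((p.2.val : ℝ) + 1) * d)

/-- A TSP tour of `G(n,d)`: a cyclic listing of all `3n` points (a Hamiltonian
cycle), given as a sequence `t` that hits every point exactly once in
positions `0,…,3n−1` and returns to its start at position `3n`. -/
def IsTour (n : ℕ) (t : ℕ → Fin n × Fin 3) : Prop :=
  Function.Bijective (fun i : Fin (3 * n) => t i) ∧ t (3 * n) = t 0

/-- The length of a TSP tour: the sum of the Euclidean distances between
consecutive points of the cycle. -/
def tourLength (n : ℕ) (d : ℝ) (t : ℕ → Fin n × Fin 3) : ℝ :=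
  ∑ i ∈ Finset.range (3 * n), eucl (pt n d (t i)) (pt n d (t (i + 1)))

/-- Feasibility for the subtour LP on the points of `G(n,d)`, with symmetric
edge variables `x i j`: degree constraints `∑_{j≠i} x i j = 2`, subtour
elimination constraints (each unordered pair is counted twice in the double
sum, whence the factor 2), and `0 ≤ x i j ≤ 1`. -/
def SubtourLPFeasible (n : ℕ) (x : Fin n × Fin 3 → Fin n × Fin 3 → ℝ) : Prop :=
  (∀ i j, x i j = x j i) ∧
  (∀ i, x i i = 0) ∧
  (∀ i j, 0 ≤ x i j ∧ x i j ≤ 1) ∧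
  (∀ i, ∑ j, x i j = 2) ∧
  (∀ S : Finset (Fin n × Fin 3), S.Nonempty → S ≠ Finset.univ →
      ∑ i ∈ S, ∑ j ∈ S, x i j ≤ 2 * ((S.card : ℝ) - 1))

/-- The objective value of the subtour LP for `G(n,d)`: each unordered pair
appears twice in the double sum, whence the factor `1/2`. -/
def lpValue (n : ℕ) (d : ℝ) (x : Fin n × Fin 3 → Fin n × Fin 3 → ℝ) : ℝ :=
  (1 / 2) * ∑ i, ∑ j, eucl (pt n d i) (pt n d j) * x i j

/-- The length of a shortest TSP tour of `G(n,d)`. -/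
def optTour (n : ℕ) (d : ℝ) : ℝ :=
  sInf {L | ∃ t, IsTour n t ∧ tourLength n d t = L}

/-- The optimum value of the subtour LP for `G(n,d)`. -/
def optLP (n : ℕ) (d : ℝ) : ℝ :=
  sInf {L | ∃ x, SubtourLPFeasible n x ∧ lpValue n d x = L}

/-- `zcost d z` is the length of a z-shaped path covering `z` points in the
middle row of `G(n,d)`. -/
def zcost (d x : ℝ) : ℝ := 2 * (x - 1) + Real.sqrt ((x - 1) ^ 2 + d ^ 2)

/-- The steps `s < N` of the walk `f` that leave the set described by `P`. -/
def exits {α : Type*} (N : ℕ) (f : ℕ → α) (P : α → Prop) : Finset ℕ :=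
  open Classical in (Finset.range N).filter fun s => P (f s) ∧ ¬ P (f (s + 1))

lemma mem_exits {α : Type*} {N : ℕ} {f : ℕ → α} {P : α → Prop} {s : ℕ} :
    s ∈ exits N f P ↔ s < N ∧ P (f s) ∧ ¬ P (f (s + 1)) := by
  simp [exits]

lemma exits_nonempty {α : Type*} {N : ℕ} {f : ℕ → α} (hf : f N = f 0) {P : α → Prop}
    (h₁ : ∃ s < N, P (f s)) (h₂ : ∃ s < N, ¬ P (f s)) : ∃ s, s ∈ exits N f P := by
  by_contra! h
  have step : ∀ s < N, P (f s) → P (f (s + 1)) := fun s hs hP => by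
    by_contra hc
    exact h s (mem_exits.2 ⟨hs, hP, hc⟩)
  have prop : ∀ a, P (f a) → ∀ b, a ≤ b → b ≤ N → P (f b) := by
    intro a ha b hab
    induction b, hab using Nat.le_induction with
    | base => exact fun _ => ha
    | succ b _ ih => exact fun hb => step b (by omega) (ih (by omega))
  obtain ⟨a, haN, ha⟩ := h₁
  obtain ⟨b, hbN, hb⟩ := h₂
  have h0 : P (f 0) := hf ▸ prop a ha N haN.le le_rfl
  exact hb (prop 0 h0 b (Nat.zero_le _) hbN.le)

/-- A closed walk leaves a set as often as it leaves the complement. -/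
lemma card_exits_not {α : Type*} {N : ℕ} {f : ℕ → α} (hf : f N = f 0) (P : α → Prop) :
    (exits N f fun a => ¬ P a).card = (exits N f P).card := by
  classical
  have tele := Finset.sum_range_sub (fun s => if P (f s) then (1 : ℤ) else 0) N
  rw [hf, sub_self] at tele
  have key : ((exits N f fun a => ¬ P a).card : ℤ) - (exits N f P).card = 0 := by
    rw [← tele, exits, exits, Finset.card_filter, Finset.card_filter]
    push_cast
    rw [← Finset.sum_sub_distrib]
    refine Finset.sum_congr rfl fun s _ => ?_
    by_cases h1 : P (f s) <;> by_cases h2 : P (f (s + 1)) <;> simp [h1, h2]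
  omega

lemma sum_range_ite_eq_sub {m a b : ℕ} (hb : b ≤ m) :
    (∑ i ∈ Finset.range m, if a ≤ i ∧ ¬ b ≤ i then 1 else 0) = b - a := by
  rw [← Finset.card_filter, ← Nat.card_Ico]
  congr 1
  ext i
  simp only [Finset.mem_filter, Finset.mem_range, Finset.mem_Ico]
  omega

/-- The total variation of an integer-valued quantity along a closed walk, counted level by
level. -/
lemma sum_abs_eq_sum_exits {α : Type*} {N : ℕ} {f : ℕ → α} (hf : f N = f 0) (g : α → ℕ) {m : ℕ}
    (hg : ∀ a, g a ≤ m) :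
    ∑ s ∈ Finset.range N, |(g (f s) : ℝ) - g (f (s + 1))| =
      ∑ i ∈ Finset.range m, 2 * ((exits N f fun a => g a ≤ i).card : ℝ) := by
  classical
  have habs : ∀ a b : ℕ, |(a : ℝ) - b| = ((b - a : ℕ) : ℝ) + ((a - b : ℕ) : ℝ) := by
    intro a b
    rcases le_total a b with h | h
    · rw [Nat.sub_eq_zero_of_le h, Nat.cast_sub h, abs_sub_comm, abs_of_nonneg]
      · simp
      · simpa using h
    · rw [Nat.sub_eq_zero_of_le h, Nat.cast_sub h, abs_of_nonneg]
      · simp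
      · simpa using h
  have hup : ∑ s ∈ Finset.range N, (g (f (s + 1)) - g (f s)) =
      ∑ i ∈ Finset.range m, (exits N f fun a => g a ≤ i).card := by
    simp_rw [exits, Finset.card_filter]
    rw [Finset.sum_comm]
    refine Finset.sum_congr rfl fun s _ => ?_
    rw [← sum_range_ite_eq_sub (hg (f (s + 1)))]
  have hdown : ∑ s ∈ Finset.range N, (g (f s) - g (f (s + 1))) =
      ∑ i ∈ Finset.range m, (exits N f fun a => g a ≤ i).card := by
    simp_rw [← card_exits_not hf (fun a => g a ≤ _), exits, Finset.card_filter]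
    rw [Finset.sum_comm]
    refine Finset.sum_congr rfl fun s _ => ?_
    rw [← sum_range_ite_eq_sub (hg (f s))]
    refine Finset.sum_congr rfl fun i _ => ?_
    simp only [not_not, and_comm]
  simp_rw [habs]
  rw [Finset.sum_add_distrib, ← Nat.cast_sum, ← Nat.cast_sum, hup, hdown, ← Finset.mul_sum]
  push_cast
  ring

lemma three_le_card_exits {n N : ℕ} {t : ℕ → Fin n × Fin 3} (hclosed : t N = t 0)
    (hsurj : ∀ p, ∃ s < N, t s = p) (S : Fin n → Prop) (hS : ∃ i, S i)
    (hrow : ∀ s < N, S (t s).1 → S (t (s + 1)).1 → (t s).2 = (t (s + 1)).2) :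
    3 ≤ (exits N t fun p => S p.1).card := by
  classical
  have himg : (Finset.univ : Finset (Fin 3)) ⊆
      (exits N t fun p => S p.1).image fun s => (t s).2 := by
    intro r _
    obtain ⟨i, hi⟩ := hS
    obtain ⟨s₁, hs₁, h₁⟩ := hsurj (i, r)
    obtain ⟨s₂, hs₂, h₂⟩ := hsurj (i, r + 1)
    obtain ⟨s, hs⟩ := exits_nonempty hclosed (P := fun p => S p.1 ∧ p.2 = r)
      ⟨s₁, hs₁, by simp [h₁, hi]⟩ ⟨s₂, hs₂, by simp [h₂]⟩
    obtain ⟨hsN, ⟨hSs, hr⟩, hnot⟩ := mem_exits.1 hs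
    refine Finset.mem_image.2 ⟨s, mem_exits.2 ⟨hsN, hSs, fun hS' => hnot ⟨hS', ?_⟩⟩, hr⟩
    rw [← hrow s hsN hSs hS', hr]
  calc 3 = (Finset.univ : Finset (Fin 3)).card := by simp
    _ ≤ _ := Finset.card_le_card himg
    _ ≤ _ := Finset.card_image_le

/-- The steps of a walk that change the row. -/
def rowChanges {n : ℕ} (N : ℕ) (t : ℕ → Fin n × Fin 3) : Finset ℕ :=
  (Finset.range N).filter fun s => (t s).2 ≠ (t (s + 1)).2

/-- If a closed walk through all points crosses each gap `i ∈ K` only twice, then it changes rows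
at least `|K| + 3` times. -/
lemma card_add_three_le_card_rowChanges {n N : ℕ} {t : ℕ → Fin n × Fin 3} (hclosed : t N = t 0)
    (hsurj : ∀ p, ∃ s < N, t s = p) (hn : 0 < n) (K : Finset ℕ) (hK : ∀ i ∈ K, i + 1 < n)
    (hcut : ∀ i ∈ K, (exits N t fun p => p.1.val ≤ i).card = 1) :
    K.card + 3 ≤ (rowChanges N t).card := by
  classical
  let cls : Fin n × Fin 3 → Finset ℕ × Fin 3 := fun p => (K.filter (· < p.1.val), p.2)
  let B : Finset ℕ := insert 0 (K.image (· + 1))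
  have hB : B.card = K.card + 1 := by
    rw [Finset.card_insert_of_notMem (by simp),
      Finset.card_image_of_injective _ (add_left_injective 1)]
  have hBn : ∀ b ∈ B, b < n := by
    intro b hb
    rcases Finset.mem_insert.1 hb with rfl | hb
    · exact hn
    · obtain ⟨i, hi, rfl⟩ := Finset.mem_image.1 hb
      exact hK i hi
  let C : Finset (Finset ℕ × Fin 3) :=
    (B.image fun b => K.filter (· < b)) ×ˢ (Finset.univ : Finset (Fin 3))
  have hlt : ∀ b b', b' ∈ B → b < b' → K.filter (· < b) ≠ K.filter (· < b') := by
    intro b b' hb' hbb' heq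
    rcases Finset.mem_insert.1 hb' with rfl | hb'
    · omega
    · obtain ⟨i, hi, rfl⟩ := Finset.mem_image.1 hb'
      have : i ∈ K.filter (· < i + 1) := Finset.mem_filter.2 ⟨hi, by omega⟩
      rw [← heq, Finset.mem_filter] at this
      omega
  have hC : C.card = 3 * (K.card + 1) := by
    rw [Finset.card_product, Finset.card_image_of_injOn, hB, Finset.card_univ, Fintype.card_fin,
      mul_comm]
    intro b hb b' hb' heq
    rcases lt_trichotomy b b' with h | h | h
    · exact absurd heq (hlt b b' hb' h)
    · exact h
    · exact absurd heq.symm (hlt b' b hb h)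
  let D : Finset ℕ := (Finset.range N).filter fun s => cls (t s) ≠ cls (t (s + 1))
  have hCD : C ⊆ D.image fun s => cls (t s) := by
    rintro ⟨F, r⟩ hc
    obtain ⟨b, hb, rfl⟩ := Finset.mem_image.1 (Finset.mem_product.1 hc).1
    obtain ⟨s₁, hs₁, h₁⟩ := hsurj (⟨b, hBn b hb⟩, r)
    obtain ⟨s₂, hs₂, h₂⟩ := hsurj (⟨b, hBn b hb⟩, r + 1)
    obtain ⟨s, hs⟩ := exits_nonempty hclosed (P := fun p => cls p = (K.filter (· < b), r))
      ⟨s₁, hs₁, by simp [h₁, cls]⟩ ⟨s₂, hs₂, by simp [h₂, cls]⟩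
    obtain ⟨hsN, hin, hout⟩ := mem_exits.1 hs
    refine Finset.mem_image.2 ⟨s, Finset.mem_filter.2 ⟨Finset.mem_range.2 hsN, ?_⟩, hin⟩
    intro h
    exact hout (h ▸ hin)
  have hD : D ⊆ rowChanges N t ∪ K.biUnion fun i =>
      (exits N t fun p => p.1.val ≤ i) ∪ exits N t fun p => ¬ p.1.val ≤ i := by
    intro s hs
    obtain ⟨hsN, hne⟩ := Finset.mem_filter.1 hs
    by_contra hnot
    simp only [Finset.mem_union, Finset.mem_biUnion, mem_exits, rowChanges, Finset.mem_filter,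
      not_or, not_exists, not_and, not_not] at hnot
    refine hne (Prod.ext (Finset.filter_congr fun i hi => ?_) (hnot.1 hsN))
    have h := hnot.2 i hi
    have h1 := h.1 (Finset.mem_range.1 hsN)
    have h2 := h.2 (Finset.mem_range.1 hsN)
    omega
  have h1 : 3 * (K.card + 1) ≤ D.card :=
    hC ▸ (Finset.card_le_card hCD).trans Finset.card_image_le
  have h2 : D.card ≤ (rowChanges N t).card + K.card * 2 := by
    refine (Finset.card_le_card hD).trans ((Finset.card_union_le _ _).trans ?_)
    gcongr
    refine Finset.card_biUnion_le_card_mul _ _ _ fun i hi => ?_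
    refine (Finset.card_union_le _ _).trans ?_
    rw [card_exits_not hclosed (fun p => p.1.val ≤ i), hcut i hi]
  omega

lemma eucl_pt {n : ℕ} (d : ℝ) (p q : Fin n × Fin 3) :
    eucl (pt n d p) (pt n d q) =
      √(|(p.1.val : ℝ) - q.1.val| ^ 2 + (|(p.2.val : ℝ) - q.2.val| * d) ^ 2) := by
  rw [eucl, pt, pt, mul_pow, sq_abs, sq_abs]
  congr 1
  ring

lemma mul_add_mul_le_sqrt {a b : ℝ} (hab : a ^ 2 + b ^ 2 ≤ 1) (x y : ℝ) :
    a * x + b * y ≤ √(x ^ 2 + y ^ 2) := by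
  refine Real.le_sqrt_of_sq_le ?_
  nlinarith [sq_nonneg (a * y - b * x), mul_nonneg (sub_nonneg.2 hab)
    (add_nonneg (sq_nonneg x) (sq_nonneg y))]

lemma one_le_abs_sub {a b : ℕ} (h : a ≠ b) : (1 : ℝ) ≤ |(a : ℝ) - b| := by
  have : (1 : ℤ) ≤ |(a : ℤ) - b| := Int.one_le_abs (by omega)
  exact_mod_cast this

lemma le_eucl_of_row_ne {n : ℕ} {d : ℝ} (hd : 0 ≤ d) {p q : Fin n × Fin 3} (h : p.2 ≠ q.2) :
    d ≤ eucl (pt n d p) (pt n d q) := by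
  rw [eucl_pt]
  refine Real.le_sqrt_of_sq_le ?_
  have h1 := one_le_abs_sub (Fin.val_ne_of_ne h)
  have h2 : d ≤ |(p.2.val : ℝ) - q.2.val| * d := le_mul_of_one_le_left hd h1
  nlinarith [sq_nonneg |(p.1.val : ℝ) - q.1.val|]

lemma le_eucl {n : ℕ} {d : ℝ} (hd : 4 ≤ d) {p q : Fin n × Fin 3} (h : p ≠ q) :
    (1 - 2 / (d + 1)) * |(p.1.val : ℝ) - q.1.val| + 2 / (d + 1) +
        (if p.2 ≠ q.2 then 2 * (1 - 2 / (d + 1)) else 0) ≤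
      eucl (pt n d p) (pt n d q) := by
  have hd1 : 0 < d + 1 := by linarith
  set e : ℝ := 2 / (d + 1) with he
  have hed : e * (d + 1) = 2 := by rw [he]; field_simp
  have he0 : 0 < e := by positivity
  by_cases hr : p.2 = q.2
  · have hc : p.1 ≠ q.1 := fun hc => h (Prod.ext hc hr)
    have h1 := one_le_abs_sub (Fin.val_ne_of_ne hc)
    rw [eucl_pt, hr]
    simp only [sub_self, abs_zero, zero_mul, ne_eq, not_true_eq_false, if_false]
    rw [zero_pow two_ne_zero, add_zero, add_zero, Real.sqrt_sq_eq_abs, abs_abs]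
    nlinarith
  · rw [if_pos hr, eucl_pt]
    have h1 := one_le_abs_sub (Fin.val_ne_of_ne hr)
    have hab : (1 - e) ^ 2 + e ^ 2 ≤ 1 := by nlinarith
    refine le_trans ?_ (mul_add_mul_le_sqrt hab _ _)
    have h2 : d ≤ |(p.2.val : ℝ) - q.2.val| * d := le_mul_of_one_le_left (by linarith) h1
    have h3 := mul_le_mul_of_nonneg_left h2 he0.le
    nlinarith

lemma IsTour.exists_lt {n : ℕ} {t : ℕ → Fin n × Fin 3} (ht : IsTour n t) (p : Fin n × Fin 3) :
    ∃ s < 3 * n, t s = p := by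
  obtain ⟨i, hi⟩ := ht.1.2 p
  exact ⟨i, i.2, hi⟩

lemma IsTour.ne_succ {n : ℕ} (hn : 0 < n) {t : ℕ → Fin n × Fin 3} (ht : IsTour n t) {s : ℕ}
    (hs : s < 3 * n) : t s ≠ t (s + 1) := by
  intro h
  rcases Nat.lt_or_ge (s + 1) (3 * n) with h1 | h1
  · have := @ht.1.1 ⟨s, hs⟩ ⟨s + 1, h1⟩ h
    simp at this
  · have h2 : s + 1 = 3 * n := by omega
    rw [h2, ht.2] at h
    have := @ht.1.1 ⟨s, hs⟩ ⟨0, by omega⟩ h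
    simp only [Fin.mk.injEq] at this
    omega

/-- A tour that crosses every gap between columns at least six times is long. -/
lemma tour_bound_of_six_crossings {n : ℕ} (hn : 3 ≤ n) {d : ℝ} (hd : 4 ≤ d)
    {t : ℕ → Fin n × Fin 3} (ht : IsTour n t)
    (h6 : ∀ i < n - 1, 3 ≤ (exits (3 * n) t fun p => p.1.val ≤ i).card) :
    4 * (n : ℝ) + 2 * d - 2 ≤ tourLength n d t := by
  have hx := sum_abs_eq_sum_exits ht.2 (fun p => p.1.val) (m := n - 1) fun p => by omega
  have hy := sum_abs_eq_sum_exits ht.2 (fun p => p.2.val) (m := 2) fun p => by omega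
  have hX : 6 * ((n : ℝ) - 1) ≤ ∑ s ∈ Finset.range (3 * n),
      |((t s).1.val : ℝ) - (t (s + 1)).1.val| := by
    rw [hx]
    calc 6 * ((n : ℝ) - 1) = ∑ i ∈ Finset.range (n - 1), (6 : ℝ) := by
          rw [Finset.sum_const, Finset.card_range, nsmul_eq_mul, Nat.cast_sub (by omega)]
          push_cast
          ring
      _ ≤ _ := by
          refine Finset.sum_le_sum fun i hi => ?_
          have : (3 : ℝ) ≤ ((exits (3 * n) t fun p => p.1.val ≤ i).card : ℝ) := by
            exact_mod_cast h6 i (Finset.mem_range.1 hi)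
          linarith
  have hY : 4 ≤ ∑ s ∈ Finset.range (3 * n), |((t s).2.val : ℝ) - (t (s + 1)).2.val| := by
    rw [hy]
    have hpos : ∀ i ∈ Finset.range 2,
        (2 : ℝ) ≤ 2 * ((exits (3 * n) t fun p => p.2.val ≤ i).card : ℝ) := by
      intro i hi
      obtain ⟨s₁, hs₁, h₁⟩ := ht.exists_lt (⟨0, by omega⟩, 0)
      obtain ⟨s₂, hs₂, h₂⟩ := ht.exists_lt (⟨0, by omega⟩, 2)
      have hi2 := Finset.mem_range.1 hi
      have hne := exits_nonempty ht.2 (P := fun p => p.2.val ≤ i)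
        ⟨s₁, hs₁, by simp [h₁]⟩ ⟨s₂, hs₂, by simpa [h₂] using hi2⟩
      have : (1 : ℝ) ≤ ((exits (3 * n) t fun p => p.2.val ≤ i).card : ℝ) := by
        exact_mod_cast Finset.card_pos.2 hne
      linarith
    refine le_trans ?_ (Finset.sum_le_sum hpos)
    norm_num
  have hlen : 4 / 5 * ∑ s ∈ Finset.range (3 * n), |((t s).1.val : ℝ) - (t (s + 1)).1.val| +
      3 / 5 * d * ∑ s ∈ Finset.range (3 * n), |((t s).2.val : ℝ) - (t (s + 1)).2.val| ≤
        tourLength n d t := by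
    rw [tourLength, Finset.mul_sum, Finset.mul_sum, ← Finset.sum_add_distrib]
    refine Finset.sum_le_sum fun s _ => ?_
    rw [eucl_pt]
    refine le_trans (le_of_eq ?_)
      (mul_add_mul_le_sqrt (a := 4 / 5) (b := 3 / 5) (by norm_num) _ _)
    ring
  have hn' : (3 : ℝ) ≤ n := by exact_mod_cast hn
  nlinarith

/-- For `n ≥ 3` and `d ≥ 4`, every TSP tour of `G(n,d)` has length at least
`4n + 2d − 2 − 2n/(d+1)`. -/
theorem statement1 (n : ℕ) (hn : 3 ≤ n) (d : ℝ) (hd : 4 ≤ d)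
    (t : ℕ → Fin n × Fin 3) (ht : IsTour n t) :
    4 * (n : ℝ) + 2 * d - 2 - 2 * n / (d + 1) ≤ tourLength n d t := by
  have hclosed := ht.2
  have hsurj := ht.exists_lt
  have hd1 : 0 < d + 1 := by linarith
  have hn' : (3 : ℝ) ≤ n := by exact_mod_cast hn
  have he0 : 0 < 2 / (d + 1) := by positivity
  have he1 : 2 / (d + 1) ≤ 1 := by rw [div_le_one hd1]; linarith
  have hdiv : 2 * (n : ℝ) / (d + 1) = 2 / (d + 1) * n := by ring
  rw [hdiv]
  set e : ℝ := 2 / (d + 1) with he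
  have hQ3 := card_add_three_le_card_rowChanges hclosed hsurj (by omega) ∅ (by simp) (by simp)
  have hQne : (rowChanges (3 * n) t).Nonempty := Finset.card_pos.1 (by omega)
  -- the first and the last row change, seen from the left
  obtain ⟨l, hl, hlmin⟩ := Finset.exists_min_image (rowChanges (3 * n) t)
    (fun s => max (t s).1.val (t (s + 1)).1.val) hQne
  obtain ⟨r, hr, hrmax⟩ := Finset.exists_max_image (rowChanges (3 * n) t)
    (fun s => min (t s).1.val (t (s + 1)).1.val) hQne
  set j := max (t l).1.val (t (l + 1)).1.val with hj
  set a := min (t r).1.val (t (r + 1)).1.val with ha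
  have mem_changes : ∀ {s}, s ∈ rowChanges (3 * n) t ↔ s < 3 * n ∧ (t s).2 ≠ (t (s + 1)).2 := by
    intro s
    simp [rowChanges]
  have hleft : ∀ i < j, 3 ≤ (exits (3 * n) t fun p => p.1.val ≤ i).card := by
    intro i hi
    refine three_le_card_exits hclosed hsurj (fun c => c.val ≤ i) ⟨⟨0, by omega⟩, by simp⟩ ?_
    intro s hs h1 h2
    by_contra hne
    have := hlmin s (mem_changes.2 ⟨hs, hne⟩)
    omega
  have hright : ∀ i, a ≤ i → i < n - 1 → 3 ≤ (exits (3 * n) t fun p => p.1.val ≤ i).card := by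
    intro i hi hin
    rw [← card_exits_not hclosed]
    refine three_le_card_exits hclosed hsurj (fun c => ¬ c.val ≤ i)
      ⟨⟨n - 1, by omega⟩, not_le.2 hin⟩ ?_
    intro s hs h1 h2
    by_contra hne
    have := hrmax s (mem_changes.2 ⟨hs, hne⟩)
    omega
  rcases Nat.lt_or_ge j a with hja | hja
  · have hlr : r ≠ l := by
      rintro rfl
      omega
    set o : ℕ → ℕ := fun i => (exits (3 * n) t fun p => p.1.val ≤ i).card with ho
    set K : Finset ℕ := (Finset.range (n - 1)).filter fun i => o i = 1 with hK
    have hQ := card_add_three_le_card_rowChanges hclosed hsurj (by omega) K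
      (fun i hi => by
        have := Finset.mem_range.1 (Finset.mem_filter.1 hi).1
        omega)
      (fun i hi => (Finset.mem_filter.1 hi).2)
    have ho1 : ∀ i < n - 1, 1 ≤ o i := by
      intro i hi
      obtain ⟨s₁, hs₁, h₁⟩ := hsurj (⟨0, by omega⟩, 0)
      obtain ⟨s₂, hs₂, h₂⟩ := hsurj (⟨n - 1, by omega⟩, 0)
      exact Finset.card_pos.2 (exits_nonempty hclosed (P := fun p => p.1.val ≤ i)
        ⟨s₁, hs₁, by simp [h₁]⟩ ⟨s₂, hs₂, by rw [h₂]; exact not_le.2 hi⟩)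
    have han : a ≤ n - 1 := by
      have := (t r).1.2
      omega
    have hcross : 2 * (n - 1) + j + (n - 1 - a) ≤ (∑ i ∈ Finset.range (n - 1), o i) + K.card := by
      have h1 : (∑ i ∈ Finset.range (n - 1), if 0 ≤ i ∧ ¬ j ≤ i then 1 else 0) = j - 0 :=
        sum_range_ite_eq_sub (by omega)
      have h2 : (∑ i ∈ Finset.range (n - 1), if a ≤ i ∧ ¬ n - 1 ≤ i then 1 else 0) = n - 1 - a :=
        sum_range_ite_eq_sub le_rfl
      have h3 : ∑ i ∈ Finset.range (n - 1), 2 = (n - 1) * 2 := by simp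
      have h4 : ∑ i ∈ Finset.range (n - 1), (2 + (if 0 ≤ i ∧ ¬ j ≤ i then 1 else 0) +
          (if a ≤ i ∧ ¬ n - 1 ≤ i then 1 else 0)) ≤
          ∑ i ∈ Finset.range (n - 1), (o i + if o i = 1 then 1 else 0) := by
        refine Finset.sum_le_sum fun i hi => ?_
        have hi' := Finset.mem_range.1 hi
        have h5 := ho1 i hi'
        have h6 : i < j → 3 ≤ o i := hleft i
        have h7 : a ≤ i → 3 ≤ o i := fun h => hright i h hi'
        split_ifs <;> omega
      rw [Finset.sum_add_distrib, Finset.sum_add_distrib, Finset.sum_add_distrib, h1, h2, h3,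
        ← Finset.card_filter, ← hK] at h4
      omega
    have hsum := sum_abs_eq_sum_exits hclosed (fun p => p.1.val) (m := n - 1) fun p => by omega
    set x : ℕ → ℝ := fun s => |((t s).1.val : ℝ) - (t (s + 1)).1.val| with hx
    have hxl : x l ≤ j := by
      have h1 : ((t l).1.val : ℝ) ≤ j := by exact_mod_cast le_max_left _ _
      have h2 : ((t (l + 1)).1.val : ℝ) ≤ j := by exact_mod_cast le_max_right _ _
      have h3 : (0 : ℝ) ≤ (t l).1.val := Nat.cast_nonneg _
      have h4 : (0 : ℝ) ≤ (t (l + 1)).1.val := Nat.cast_nonneg _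
      exact abs_le.2 ⟨by linarith, by linarith⟩
    have hxr : x r ≤ (n : ℝ) - 1 - a := by
      have h1 : (a : ℝ) ≤ (t r).1.val := by exact_mod_cast min_le_left _ _
      have h2 : (a : ℝ) ≤ (t (r + 1)).1.val := by exact_mod_cast min_le_right _ _
      have h3 : ((t r).1.val : ℝ) + 1 ≤ n := by exact_mod_cast (t r).1.2
      have h4 : ((t (r + 1)).1.val : ℝ) + 1 ≤ n := by exact_mod_cast (t (r + 1)).1.2
      exact abs_le.2 ⟨by linarith, by linarith⟩
    have hX : 4 * ((n : ℝ) - 1) + 2 * j + 2 * ((n : ℝ) - 1 - a) - 2 * K.card ≤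
        ∑ s ∈ Finset.range (3 * n), x s := by
      rw [hsum, ← Finset.mul_sum, ← Nat.cast_sum]
      have h1 : ((2 * (n - 1) + j + (n - 1 - a) : ℕ) : ℝ) ≤
          (((∑ i ∈ Finset.range (n - 1), o i) + K.card : ℕ) : ℝ) := by exact_mod_cast hcross
      rw [Nat.cast_add, Nat.cast_add, Nat.cast_add, Nat.cast_mul, Nat.cast_sub han,
        Nat.cast_sub (by omega : 1 ≤ n)] at h1
      push_cast at h1 ⊢
      linarith
    set w : ℕ → ℝ := fun s =>
      (1 - e) * x s + e + (if (t s).2 ≠ (t (s + 1)).2 then 2 * (1 - e) else 0) with hw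
    set len : ℕ → ℝ := fun s => eucl (pt n d (t s)) (pt n d (t (s + 1))) with hlen
    obtain ⟨hlN, hlrow⟩ := mem_changes.1 hl
    obtain ⟨hrN, hrrow⟩ := mem_changes.1 hr
    have hlmem : l ∈ Finset.range (3 * n) := Finset.mem_range.2 hlN
    have hrmem : r ∈ (Finset.range (3 * n)).erase l :=
      Finset.mem_erase.2 ⟨hlr, Finset.mem_range.2 hrN⟩
    have hrest : ∑ s ∈ ((Finset.range (3 * n)).erase l).erase r, w s ≤
        ∑ s ∈ ((Finset.range (3 * n)).erase l).erase r, len s := by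
      refine Finset.sum_le_sum fun s hs => le_eucl hd (ht.ne_succ (by omega) ?_)
      exact Finset.mem_range.1 (Finset.mem_of_mem_erase (Finset.mem_of_mem_erase hs))
    have split : ∀ g : ℕ → ℝ, ∑ s ∈ Finset.range (3 * n), g s =
        g l + (g r + ∑ s ∈ ((Finset.range (3 * n)).erase l).erase r, g s) := by
      intro g
      rw [Finset.add_sum_erase _ _ hrmem, Finset.add_sum_erase _ _ hlmem]
    have hwsum : ∑ s ∈ Finset.range (3 * n), w s =
        (1 - e) * ∑ s ∈ Finset.range (3 * n), x s + e * (3 * n) +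
          2 * (1 - e) * (rowChanges (3 * n) t).card := by
      rw [hw, Finset.sum_add_distrib, Finset.sum_add_distrib, ← Finset.mul_sum, Finset.sum_const,
        Finset.card_range, ← Finset.sum_filter, Finset.sum_const, rowChanges, nsmul_eq_mul,
        nsmul_eq_mul]
      push_cast
      ring
    have hwl : w l = (1 - e) * x l + e + 2 * (1 - e) := by simp [hw, hlrow]
    have hwr : w r = (1 - e) * x r + e + 2 * (1 - e) := by simp [hw, hrrow]
    have hdl : d ≤ len l := le_eucl_of_row_ne (by linarith) hlrow
    have hdr : d ≤ len r := le_eucl_of_row_ne (by linarith) hrrow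
    have hQ' : (K.card : ℝ) + 3 ≤ (rowChanges (3 * n) t).card := by exact_mod_cast hQ
    have hj0 : (0 : ℝ) ≤ j := Nat.cast_nonneg _
    have ha0 : (a : ℝ) ≤ (n : ℝ) - 1 := by
      have : ((a + 1 : ℕ) : ℝ) ≤ n := by exact_mod_cast (by omega : a + 1 ≤ n)
      push_cast at this
      linarith
    have hfinal : (1 - e) * (4 * ((n : ℝ) - 1) + 2) ≤
        (1 - e) * (∑ s ∈ Finset.range (3 * n), x s - x l - x r +
          2 * ((rowChanges (3 * n) t).card - 2)) :=
      mul_le_mul_of_nonneg_left (by linarith) (by linarith)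
    have hsplitw := split w
    have htotal : tourLength n d t = ∑ s ∈ Finset.range (3 * n), len s := rfl
    rw [htotal, split len]
    linarith
  · have := tour_bound_of_six_crossings hn hd ht fun i hi => by
      rcases Nat.lt_or_ge i j with h | h
      · exact hleft i h
      · exact hright i (by omega) hi
    have : 0 ≤ e * (n : ℝ) := by positivity
    linarith

end
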